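/- Let K be a number field with ring of integers 𝓞_K, and let h be a polynomial in x with coefficients in 𝓞_K[t] which, viewed as a polynomial over K(t), is irreducible of degree D ≥ 1 in x. Suppose K is algebraically closed in a splitting field of h over K(t). Then for all but finitely many nonzero prime ideals 𝔭 of 𝓞_K, writing κ(𝔭) = 𝓞_K/𝔭 and h_𝔭 for the polynomial over κ(𝔭)[t] obtained by reducing the coefficients of h modulo 𝔭: h_𝔭 has degree D in x and has D distinct roots in an algebraic closure of κ(𝔭)(t), and the Galois group of a splitting field of h_𝔭 over κ(𝔭)(t) has the same order as the Galois group of a splitting field of h over K(t). -/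

import Mathlib

open NumberField Polynomial

/-- The canonical map `𝓞_K[t] → K(t)`. -/
noncomputable def toRatFuncConst (K : Type*) [Field K] [NumberField K] :
    Polynomial (𝓞 K) →+* RatFunc K :=
  (algebraMap (Polynomial K) (RatFunc K)).comp (Polynomial.mapRingHom (algebraMap (𝓞 K) K))

/-- The embedding of the constant field `K` into a splitting field of a polynomial
over `K(t)`. -/
noncomputable def constEmb (K : Type*) [Field K] [NumberField K]
    (h : Polynomial (RatFunc K)) : K →+* h.SplittingField :=
  (algebraMap (RatFunc K) h.SplittingField).comp (algebraMap K (RatFunc K))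

/-- The good specialization property at a maximal ideal `𝔭` of `𝓞_K`: the reduction
`h_𝔭` of `h` modulo `𝔭` (a polynomial over `κ(𝔭)(t)`) has degree `D` in `x`, has `D`
distinct roots in an algebraic closure of `κ(𝔭)(t)`, and the Galois group of its
splitting field over `κ(𝔭)(t)` has order `N`. -/
noncomputable def specializesWell {K : Type*} [Field K] [NumberField K]
    (h : Polynomial (Polynomial (𝓞 K))) (D N : ℕ)
    (𝔭 : Ideal (𝓞 K)) (hp : 𝔭.IsMaximal) : Prop :=
  letI := hp
  (Polynomial.map
      ((algebraMap (Polynomial (𝓞 K ⧸ 𝔭)) (RatFunc (𝓞 K ⧸ 𝔭))).comp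
        (Polynomial.mapRingHom (Ideal.Quotient.mk 𝔭))) h).natDegree = D ∧
  ((Polynomial.map
      ((algebraMap (Polynomial (𝓞 K ⧸ 𝔭)) (RatFunc (𝓞 K ⧸ 𝔭))).comp
        (Polynomial.mapRingHom (Ideal.Quotient.mk 𝔭))) h).rootSet
      (AlgebraicClosure (RatFunc (𝓞 K ⧸ 𝔭)))).ncard = D ∧
  Nat.card (Polynomial.map
      ((algebraMap (Polynomial (𝓞 K ⧸ 𝔭)) (RatFunc (𝓞 K ⧸ 𝔭))).comp
        (Polynomial.mapRingHom (Ideal.Quotient.mk 𝔭))) h).Gal = N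


open scoped IntermediateField
set_option linter.unusedSectionVars false
set_option linter.style.haveILetI false
universe u v

theorem coeff_coeff_swap {R : Type*} [CommRing R] (p : R[X][X]) (i j : ℕ) :
    ((Bivariate.swap p).coeff i).coeff j = (p.coeff j).coeff i := by
  induction p using Polynomial.induction_on' with
  | add p q hp hq => simp only [map_add, coeff_add, hp, hq]
  | monomial n a =>
    induction a using Polynomial.induction_on' with
    | add p q hp hq => simp only [map_add, coeff_add, hp, hq]
    | monomial m a =>
      rw [Bivariate.swap_monomial_monomial]
      simp only [coeff_monomial]
      split_ifs <;> simp_all [coeff_monomial]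

theorem natDegree_coeff_le_swap {R : Type*} [CommRing R] (p : R[X][X]) (i : ℕ) :
    (p.coeff i).natDegree ≤ (Bivariate.swap p).natDegree := by
  rw [natDegree_le_iff_coeff_eq_zero]
  intro n hn
  rw [← coeff_coeff_swap, coeff_eq_zero_of_natDegree_lt hn, coeff_zero]

theorem natDegree_swap_map_le {R S : Type*} [CommRing R] [CommRing S] (φ : R →+* S) (p : R[X][X]) :
    (Bivariate.swap (p.map (mapRingHom φ))).natDegree ≤ (Bivariate.swap p).natDegree := by
  rw [natDegree_le_iff_coeff_eq_zero]
  intro n hn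
  ext j
  rw [coeff_coeff_swap, coeff_map, coe_mapRingHom, coeff_map, ← coeff_coeff_swap,
    coeff_eq_zero_of_natDegree_lt hn]
  simp

/-- Factors of a bivariate polynomial have bounded degree in the inner variable. -/
theorem natDegree_coeff_le_of_mul {R : Type*} [CommRing R] [IsDomain R] {f g h : R[X][X]}
    (hf : f ≠ 0) (hgh : g * h = f) (i : ℕ) :
    (g.coeff i).natDegree ≤ (Bivariate.swap f).natDegree := by
  refine (natDegree_coeff_le_swap g i).trans ?_
  have hg0 : g ≠ 0 := by rintro rfl; simp at hgh; exact hf hgh.symm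
  have hh0 : h ≠ 0 := by rintro rfl; simp at hgh; exact hf hgh.symm
  rw [← hgh, map_mul, natDegree_mul]
  · omega
  · simpa using hg0
  · simpa using hh0

/-- The polynomial in two variables with coefficients `v`. -/
noncomputable def genPoly {R : Type*} [CommRing R] (N M : ℕ) (v : Fin N × Fin M → R) : R[X][X] :=
  ∑ ij : Fin N × Fin M, monomial (ij.1 : ℕ) (monomial (ij.2 : ℕ) (v ij))

theorem genPoly_map {R S : Type*} [CommRing R] [CommRing S] (N M : ℕ) (v : Fin N × Fin M → R)
    (φ : R →+* S) : (genPoly N M v).map (mapRingHom φ) = genPoly N M (fun i => φ (v i)) := by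
  simp [genPoly, Polynomial.map_sum]

theorem genPoly_natDegree {R : Type*} [CommRing R] (N M : ℕ) (hN : 0 < N)
    (v : Fin N × Fin M → R) : (genPoly N M v).natDegree < N := by
  have : (genPoly N M v).natDegree ≤ N - 1 := by
    apply natDegree_sum_le_of_forall_le
    intro ij _
    refine (natDegree_monomial_le _).trans ?_
    have := ij.1.2
    omega
  omega

theorem exists_genPoly {R : Type*} [CommRing R] (N M : ℕ) (g : R[X][X]) (h1 : g.natDegree < N)
    (h2 : ∀ i, (g.coeff i).natDegree < M) : ∃ v, genPoly N M v = g := by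
  refine ⟨fun ij => (g.coeff ij.1).coeff ij.2, ?_⟩
  rw [genPoly, Fintype.sum_prod_type]
  conv_rhs => rw [g.as_sum_range' N h1, ← Fin.sum_univ_eq_sum_range (fun i => monomial i (g.coeff i))]
  refine Finset.sum_congr rfl fun i _ => ?_
  conv_rhs => rw [(g.coeff i).as_sum_range' M (h2 i),
    ← Fin.sum_univ_eq_sum_range (fun j => monomial j ((g.coeff i).coeff j))]
  rw [map_sum]


attribute [local instance] MvPolynomial.algebraMvPolynomial in
/-- A form of the Bertini-Noether theorem. -/
theorem bertini_noether {O K : Type u} [CommRing O] [IsDomain O] [Field K] [Algebra O K]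
    [IsFractionRing O K] (f : O[X][X]) (hf : f.Monic) (hN : 0 < f.natDegree)
    (habs : ∀ (K' : Type u) [Field K'] [Algebra K K'] [Module.Finite K K'] (G H : K'[X][X]),
      G.natDegree < f.natDegree → H.natDegree < f.natDegree →
      G * H ≠ f.map (mapRingHom ((algebraMap K K').comp (algebraMap O K)))) :
    ∃ d : O, d ≠ 0 ∧ ∀ (k : Type u) [Field k] (φ : O →+* k), φ d ≠ 0 →
      Irreducible (f.map (mapRingHom φ)) := by
  set N := f.natDegree with hNdef
  set M := (Bivariate.swap f).natDegree + 1 with hM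
  let G0 : (MvPolynomial (Bool × Fin N × Fin M) O)[X][X] := genPoly N M (fun ij => MvPolynomial.X (true, ij))
  let H0 : (MvPolynomial (Bool × Fin N × Fin M) O)[X][X] := genPoly N M (fun ij => MvPolynomial.X (false, ij))
  let Q : (MvPolynomial (Bool × Fin N × Fin M) O)[X][X] := G0 * H0 - f.map (mapRingHom MvPolynomial.C)
  let J : Ideal (MvPolynomial (Bool × Fin N × Fin M) O) := Ideal.span (Set.range fun ij : ℕ × ℕ => (Q.coeff ij.1).coeff ij.2)
  have key : ∀ (S : Type u) [CommRing S] (ψ : (MvPolynomial (Bool × Fin N × Fin M) O) →+* S),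
      Q.map (mapRingHom ψ) = 0 ↔ ∀ x ∈ J, ψ x = 0 := by
    intro S _ ψ
    constructor
    · intro hQ
      have : J ≤ RingHom.ker ψ := by
        rw [Ideal.span_le]
        rintro _ ⟨ij, rfl⟩
        have := congrArg (fun q => (q.coeff ij.1).coeff ij.2) hQ
        simpa using this
      exact this
    · intro hJ
      ext i j
      simpa using hJ _ (Ideal.subset_span ⟨(i, j), rfl⟩)
  by_cases hex : ∃ d : O, d ≠ 0 ∧ MvPolynomial.C d ∈ J
  · obtain ⟨d, hd, hdJ⟩ := hex
    refine ⟨d, hd, fun k _ φ hφ => ?_⟩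
    have hfm : (f.map (mapRingHom φ)).Monic := hf.map _
    have hdeg : (f.map (mapRingHom φ)).natDegree = N := hf.natDegree_map _
    rw [hfm.irreducible_iff_natDegree']
    refine ⟨fun h1 => ?_, fun g h hg hh hgh hmem => ?_⟩
    · rw [h1, natDegree_one] at hdeg; omega
    · rw [Finset.mem_Ioc] at hmem
      have hsum : g.natDegree + h.natDegree = N := by
        rw [← hdeg, ← hgh, hg.natDegree_mul hh]
      have hsw := natDegree_swap_map_le φ f
      have hhg : h * g = f.map (mapRingHom φ) := by rw [mul_comm, hgh]
      obtain ⟨v, hv⟩ := exists_genPoly N M g (by omega)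
        (fun i => by have := natDegree_coeff_le_of_mul hfm.ne_zero hgh i; omega)
      obtain ⟨w, hw⟩ := exists_genPoly N M h (by omega)
        (fun i => by have := natDegree_coeff_le_of_mul hfm.ne_zero hhg i; omega)
      let ψ : (MvPolynomial (Bool × Fin N × Fin M) O) →+* k := MvPolynomial.eval₂Hom φ (fun b => if b.1 then v b.2 else w b.2)
      apply hφ
      have h3 := (key k ψ).1 ?_ _ hdJ
      · simpa [ψ] using h3
      · simp only [Q, Polynomial.map_sub, Polynomial.map_mul, G0, H0, genPoly_map, Polynomial.map_map,
          mapRingHom_comp]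
        have : ψ.comp MvPolynomial.C = φ := by ext; simp [ψ]
        rw [this]
        simp [ψ, hv, hw, hgh]
  · exfalso
    have hne : J.map (algebraMap (MvPolynomial (Bool × Fin N × Fin M) O) (MvPolynomial (Bool × Fin N × Fin M) K)) ≠ ⊤ := by
      intro htop
      have h1 : (1 : MvPolynomial (Bool × Fin N × Fin M) K) ∈ J.map (algebraMap (MvPolynomial (Bool × Fin N × Fin M) O) (MvPolynomial (Bool × Fin N × Fin M) K)) := by
        rw [htop]; trivial
      rw [IsLocalization.mem_map_algebraMap_iff
        ((nonZeroDivisors O).map (MvPolynomial.C (σ := Bool × Fin N × Fin M)))] at h1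
      obtain ⟨⟨⟨a, ha⟩, ⟨s, hs⟩⟩, hx⟩ := h1
      obtain ⟨d, hd, rfl⟩ := hs
      refine hex ⟨d, nonZeroDivisors.ne_zero hd, ?_⟩
      rw [one_mul] at hx
      have hinj : Function.Injective (algebraMap (MvPolynomial (Bool × Fin N × Fin M) O) (MvPolynomial (Bool × Fin N × Fin M) K)) := by
        rw [MvPolynomial.algebraMap_def]
        exact MvPolynomial.map_injective _ (IsFractionRing.injective O K)
      have := hinj hx
      simp only at this
      change MvPolynomial.C d = a at this
      rw [this]; exact ha
    obtain ⟨m, hm, hJm⟩ := Ideal.exists_le_maximal _ hne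
    let := Ideal.Quotient.field m
    have : Module.Finite K (MvPolynomial (Bool × Fin N × Fin M) K ⧸ m) := finite_of_finite_type_of_isJacobsonRing K _
    let ψ : (MvPolynomial (Bool × Fin N × Fin M) O) →+* (MvPolynomial (Bool × Fin N × Fin M) K ⧸ m) :=
      (Ideal.Quotient.mk m).comp (algebraMap (MvPolynomial (Bool × Fin N × Fin M) O) (MvPolynomial (Bool × Fin N × Fin M) K))
    have hQ := (key _ ψ).2 (fun x hx => Ideal.Quotient.eq_zero_iff_mem.2
      (hJm (Ideal.mem_map_of_mem _ hx)))
    refine habs (MvPolynomial (Bool × Fin N × Fin M) K ⧸ m) (G0.map (mapRingHom ψ)) (H0.map (mapRingHom ψ)) ?_ ?_ ?_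
    · rw [genPoly_map]; exact genPoly_natDegree _ _ hN _
    · rw [genPoly_map]; exact genPoly_natDegree _ _ hN _
    · simp only [Q, Polynomial.map_sub, Polynomial.map_mul, Polynomial.map_map,
          mapRingHom_comp] at hQ
      rw [sub_eq_zero.1 hQ]
      congr 2
      ext x
      simp only [ψ, RingHom.comp_apply, MvPolynomial.algebraMap_def, MvPolynomial.map_C]
      rfl

theorem abs_irr {K E L K' : Type*} [Field K] [CharZero K] [Field E] [Field L] [Algebra K E]
    [Algebra E L] [Algebra K L] [IsScalarTower K E L] [FiniteDimensional E L]
    (halg : ∀ x : L, IsIntegral K x → x ∈ Set.range (algebraMap K L))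
    (θ : L) (hθ : E⟮θ⟯ = ⊤) (t : E) (f : K[X][X]) (hf : f.Monic)
    (hdeg : f.natDegree = Module.finrank E L)
    (hroot : aeval θ (f.map (aeval (R := K) t : K[X] →ₐ[K] E).toRingHom) = 0)
    [Field K'] [Algebra K K'] [Module.Finite K K'] (G H : K'[X][X])
    (hG : G.natDegree < f.natDegree) (hH : H.natDegree < f.natDegree)
    (hGH : G * H = f.map (mapRingHom (algebraMap K K'))) : False := by
  let τ : K' →ₐ[K] AlgebraicClosure L := IsAlgClosed.lift
  obtain ⟨c, hc⟩ := Field.exists_primitive_element K K'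
  have hcint : IsIntegral K c := IsIntegral.of_finite K c
  set c' : AlgebraicClosure L := τ c with hc'
  have hmin : minpoly K c' = minpoly K c := minpoly.algHom_eq τ τ.injective c
  set n := (minpoly K c').natDegree with hn
  have hcint' : IsIntegral K c' := hcint.map τ
  have hnpos : 0 < n := minpoly.natDegree_pos hcint'
  have hcL : IsIntegral L c' := hcint'.tower_top
  have hcE : IsIntegral E c' := hcint'.tower_top
  have h1 : n ≤ (minpoly L c').natDegree := by
    have hl := integralClosure.mem_lifts_of_monic_of_dvd_map L (minpoly.monic hcint')
      (minpoly.monic hcL) (minpoly.dvd_map_of_isScalarTower K L c')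
    have hl2 : minpoly L c' ∈ lifts (algebraMap K L) := by
      rw [lifts_iff_coeff_lifts] at hl ⊢
      intro i
      obtain ⟨y, hy⟩ := hl i
      rw [← hy]
      exact halg _ y.2
    obtain ⟨q, hq, hqd, hqm⟩ := lifts_and_natDegree_eq_and_monic hl2 (minpoly.monic hcL)
    rw [← hqd]
    apply natDegree_le_natDegree
    apply minpoly.min K c' hqm
    have := minpoly.aeval L c'
    rw [← hq, aeval_map_algebraMap] at this
    exact this
  have h2 : (minpoly E c').natDegree ≤ n := by
    have := natDegree_le_of_dvd (minpoly.dvd_map_of_isScalarTower K E c')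
      (by simpa using minpoly.ne_zero hcint')
    simpa using this
  let Ec : IntermediateField E (AlgebraicClosure L) := E⟮c'⟯
  have hcEc : c' ∈ Ec := IntermediateField.mem_adjoin_simple_self E c'
  have hτ : ∀ y, τ y ∈ Ec := by
    intro y
    have hle : K⟮c⟯ ≤ (Ec.restrictScalars K).comap τ := by
      rw [IntermediateField.adjoin_simple_le_iff]
      exact hcEc
    exact hle (by rw [hc]; trivial : y ∈ K⟮c⟯)
  let τ' : K' →+* Ec := (τ : K' →+* AlgebraicClosure L).codRestrict Ec hτ
  let ρ : K'[X] →+* Ec := eval₂RingHom τ' (algebraMap E Ec t)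
  set θ' : AlgebraicClosure L := algebraMap L _ θ with hθ'
  have hρ : (algebraMap Ec (AlgebraicClosure L)).comp (ρ.comp (mapRingHom (algebraMap K K'))) =
      (algebraMap E (AlgebraicClosure L)).comp (aeval (R := K) t : K[X] →ₐ[K] E).toRingHom := by
    ext x
    · simp only [ρ, RingHom.comp_apply, coe_mapRingHom, map_C, coe_eval₂RingHom, eval₂_C]
      change τ (algebraMap K K' x) = algebraMap E _ (aeval t (C x))
      rw [aeval_C, τ.commutes, ← IsScalarTower.algebraMap_apply]
    · simp only [ρ, RingHom.comp_apply, coe_mapRingHom, map_X, coe_eval₂RingHom, eval₂_X]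
      change _ = algebraMap E _ (aeval t X)
      rw [aeval_X, ← IsScalarTower.algebraMap_apply]
  have hprod : aeval θ' (G.map ρ) * aeval θ' (H.map ρ) = 0 := by
    rw [← map_mul, ← Polynomial.map_mul, hGH, Polynomial.map_map, aeval_def, eval₂_map, hρ,
      ← eval₂_map, ← aeval_def, hθ', aeval_algebraMap_apply, hroot, map_zero]
  have hne : G.map ρ * H.map ρ ≠ 0 := by
    rw [← Polynomial.map_mul, hGH, Polynomial.map_map]
    exact (hf.map _).ne_zero
  have hcθ : IsIntegral Ec θ' :=
    ((IsIntegral.of_finite E θ).map (IsScalarTower.toAlgHom E L (AlgebraicClosure L))).tower_top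
  have : FiniteDimensional E Ec := IntermediateField.adjoin.finiteDimensional hcE
  have : FiniteDimensional Ec Ec⟮θ'⟯ := IntermediateField.adjoin.finiteDimensional hcθ
  have : FiniteDimensional L L⟮c'⟯ := IntermediateField.adjoin.finiteDimensional hcL
  have : FiniteDimensional E Ec⟮θ'⟯ := FiniteDimensional.trans E Ec _
  have hincl : L⟮c'⟯.restrictScalars E ≤ Ec⟮θ'⟯.restrictScalars E := by
    have hθm : θ' ∈ Ec⟮θ'⟯ := IntermediateField.mem_adjoin_simple_self _ θ'
    intro x hx
    rw [IntermediateField.mem_restrictScalars] at hx ⊢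
    induction hx using IntermediateField.adjoin_induction with
    | mem x hx =>
      rw [Set.mem_singleton_iff.1 hx]
      exact Ec⟮θ'⟯.algebraMap_mem ⟨c', hcEc⟩
    | algebraMap x =>
      have hle : E⟮θ⟯ ≤ (Ec⟮θ'⟯.restrictScalars E).comap
          (IsScalarTower.toAlgHom E L (AlgebraicClosure L)) := by
        rw [IntermediateField.adjoin_simple_le_iff]
        exact hθm
      exact hle (by rw [hθ]; trivial : x ∈ E⟮θ⟯)
    | add x y _ _ hx hy => exact add_mem hx hy
    | inv x _ hx => exact inv_mem hx
    | mul x y _ _ hx hy => exact mul_mem hx hy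
  have hfr : Module.finrank E L⟮c'⟯ ≤ Module.finrank E Ec⟮θ'⟯ := by
    have hle : Subalgebra.toSubmodule (L⟮c'⟯.restrictScalars E).toSubalgebra ≤
      Subalgebra.toSubmodule (Ec⟮θ'⟯.restrictScalars E).toSubalgebra := hincl
    have : Module.Finite E (Subalgebra.toSubmodule (Ec⟮θ'⟯.restrictScalars E).toSubalgebra) :=
      inferInstanceAs (FiniteDimensional E Ec⟮θ'⟯)
    exact Submodule.finrank_mono hle
  rw [← Module.finrank_mul_finrank E L L⟮c'⟯, ← Module.finrank_mul_finrank E Ec Ec⟮θ'⟯,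
    IntermediateField.adjoin.finrank hcL, IntermediateField.adjoin.finrank hcθ,
    IntermediateField.adjoin.finrank hcE, ← hdeg] at hfr
  have aux : ∀ G : K'[X][X], G.natDegree < f.natDegree → G.map ρ ≠ 0 → aeval θ' (G.map ρ) = 0 →
      False := by
    intro G hG hG0 hGθ
    have h3 : (minpoly Ec θ').natDegree < f.natDegree :=
      (natDegree_le_of_dvd (minpoly.dvd _ _ hGθ) hG0).trans_lt (natDegree_map_le.trans_lt hG)
    have h4 : (minpoly E c').natDegree * (minpoly Ec θ').natDegree < n * f.natDegree :=
      (Nat.mul_le_mul_right _ h2).trans_lt (Nat.mul_lt_mul_of_pos_left h3 hnpos)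
    have h5 : n * f.natDegree ≤ f.natDegree * (minpoly L c').natDegree := by
      rw [mul_comm]; exact Nat.mul_le_mul_left _ h1
    omega
  rcases mul_eq_zero.1 hprod with h | h
  · exact aux G hG (left_ne_zero_of_mul hne) h
  · exact aux H hH (right_ne_zero_of_mul hne) h

section spec
variable {A E L : Type*} [CommRing A] [IsDomain A] [Field E] [Field L] [Algebra A E]
    [IsFractionRing A E] [Algebra E L] [Algebra A L] [IsScalarTower A E L]

/-- Reduction map `A[x] → k[x]/(f_φ)`. -/
noncomputable def spMap {k : Type v} [Field k] (f : A[X]) (φ : A →+* k) :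
    A[X] →+* AdjoinRoot (f.map φ) :=
  (AdjoinRoot.mk (f.map φ)).comp (mapRingHom φ)

theorem spMap_C {k : Type v} [Field k] (f : A[X]) (φ : A →+* k) (a : A) :
    spMap f φ (C a) = algebraMap k _ (φ a) := by
  simp [spMap, AdjoinRoot.algebraMap_eq]

theorem spMap_eq_zero {k : Type v} [Field k] (f : A[X]) (φ : A →+* k) (hf : f.Monic) (θ : L)
    (hmin : f.map (algebraMap A E) = minpoly E θ) (P : A[X]) (hP : aeval θ P = 0) :
    spMap f φ P = 0 := by
  have h1 : f ∣ P := by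
    rw [← Polynomial.map_dvd_map (algebraMap A E) (IsFractionRing.injective A E) hf, hmin]
    apply minpoly.dvd
    rwa [aeval_map_algebraMap]
  simp only [spMap, RingHom.comp_apply, AdjoinRoot.mk_eq_zero]
  exact Polynomial.map_dvd φ h1

theorem exists_denom (θ : L) (hθ : Algebra.adjoin E {θ} = ⊤) (x : L) :
    ∃ s : A, s ≠ 0 ∧ ∃ P : A[X], algebraMap A L s * x = aeval θ P := by
  have hx : x ∈ Algebra.adjoin E {θ} := by rw [hθ]; trivial
  rw [Algebra.adjoin_singleton_eq_range_aeval] at hx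
  obtain ⟨q, rfl⟩ := hx
  obtain ⟨b, hbM, hb⟩ := IsLocalization.integerNormalization_spec (nonZeroDivisors A) q
  refine ⟨b, nonZeroDivisors.ne_zero hbM, IsLocalization.integerNormalization (nonZeroDivisors A) q, ?_⟩
  rw [← aeval_map_algebraMap E, hb]
  change _ = aeval θ (_ • q)
  rw [← algebraMap_smul E, map_smul, Algebra.smul_def, ← IsScalarTower.algebraMap_apply]
  rfl

theorem spec_root {k : Type v} [Field k] (f : A[X]) (φ : A →+* k) (hf : f.Monic) (θ : L)
    [Fact (Irreducible (f.map φ))]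
    (hmin : f.map (algebraMap A E) = minpoly E θ) (h P : A[X]) (s : A) (hs : φ s ≠ 0)
    (α : L) (hα : aeval α h = 0) (hP : algebraMap A L s * α = aeval θ P) :
    ∃ y : AdjoinRoot (f.map φ), eval₂ (algebraMap k _) y (h.map φ) = 0 ∧
      spMap f φ P = algebraMap k _ (φ s) * y := by
  have hs' : algebraMap k (AdjoinRoot (f.map φ)) (φ s) ≠ 0 := by simpa using hs
  refine ⟨spMap f φ P / algebraMap k _ (φ s), ?_, by field_simp⟩
  have h1 : aeval θ (eval₂ C P (scaleRoots h s)) = 0 := by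
    have := hom_eval₂ (scaleRoots h s) C (aeval (R := A) θ).toRingHom P
    change aeval θ (eval₂ C P (scaleRoots h s)) = _ at this
    rw [this]
    change eval₂ _ (aeval θ P) _ = 0
    rw [← hP]
    have e : ((aeval (R := A) θ).toRingHom.comp C) = algebraMap A L := by
      ext; simp
    rw [e, scaleRoots_eval₂_mul, ← aeval_def, hα, mul_zero]
  have h2 := spMap_eq_zero f φ hf θ hmin _ h1
  have e : (spMap f φ).comp C = (algebraMap k _).comp φ := by
    ext a; exact spMap_C f φ a
  rw [hom_eval₂, e] at h2
  have e2 : spMap f φ P = ((algebraMap k _).comp φ) s *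
      (spMap f φ P / algebraMap k (AdjoinRoot (f.map φ)) (φ s)) := by
    simp only [RingHom.comp_apply]; field_simp
  rw [e2, scaleRoots_eval₂_mul] at h2
  rw [eval₂_map]
  exact (mul_eq_zero.1 h2).resolve_left (pow_ne_zero _ hs')

theorem spec_gen (f : A[X]) (hf : f.Monic) (θ : L) (hθ : Algebra.adjoin E {θ} = ⊤)
    (hmin : f.map (algebraMap A E) = minpoly E θ) (h : A[X]) (hh : h ≠ 0)
    (hadj : Algebra.adjoin E ((h.map (algebraMap A E)).rootSet L) = ⊤) :
    ∃ s : A, s ≠ 0 ∧ ∀ (k : Type v) [Field k] (φ : A →+* k) [Fact (Irreducible (f.map φ))],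
      φ s ≠ 0 → Algebra.adjoin k ((h.map φ).rootSet (AdjoinRoot (f.map φ))) = ⊤ := by
  have good : ∀ x : L, ∃ s : A, s ≠ 0 ∧ ∃ P : A[X], algebraMap A L s * x = aeval θ P ∧
      ∀ (k : Type v) [Field k] (φ : A →+* k) [Fact (Irreducible (f.map φ))],
      φ s ≠ 0 → spMap f φ P ∈ Algebra.adjoin k ((h.map φ).rootSet (AdjoinRoot (f.map φ))) := by
    intro x
    have hx : x ∈ Algebra.adjoin E ((h.map (algebraMap A E)).rootSet L) := by rw [hadj]; trivial
    induction hx using Algebra.adjoin_induction with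
    | mem α hα =>
      obtain ⟨s, hs, P, hP⟩ := exists_denom (A := A) θ hθ α
      refine ⟨s * h.leadingCoeff, mul_ne_zero hs (leadingCoeff_ne_zero.2 hh),
        C h.leadingCoeff * P, ?_, ?_⟩
      · rw [map_mul, map_mul, ← hP, aeval_C]; ring
      · intro k _ φ _ hφ
        rw [map_mul] at hφ
        have hα' : aeval α h = 0 := by
          have := (mem_rootSet.1 hα).2
          rwa [aeval_map_algebraMap] at this
        obtain ⟨y, hy, hPy⟩ := spec_root f φ hf θ hmin h P s (left_ne_zero_of_mul hφ) α hα' hP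
        rw [map_mul, spMap_C, hPy]
        refine mul_mem (Subalgebra.algebraMap_mem _ _) (mul_mem (Subalgebra.algebraMap_mem _ _) ?_)
        apply Algebra.subset_adjoin
        rw [mem_rootSet]
        refine ⟨fun h0 => right_ne_zero_of_mul hφ ?_, hy⟩
        rw [leadingCoeff, ← coeff_map, h0, coeff_zero]
    | algebraMap e =>
      obtain ⟨⟨a, b⟩, hab⟩ := IsLocalization.surj (nonZeroDivisors A) e
      refine ⟨b, nonZeroDivisors.ne_zero b.2, C a, ?_, ?_⟩
      · rw [aeval_C, IsScalarTower.algebraMap_apply A E L, IsScalarTower.algebraMap_apply A E L,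
          ← map_mul, mul_comm, hab]
      · intro k _ φ _ _
        rw [spMap_C]; exact Subalgebra.algebraMap_mem _ _
    | add x y _ _ hx hy =>
      obtain ⟨s, hs, P, hP, hPk⟩ := hx
      obtain ⟨t, ht, Q, hQ, hQk⟩ := hy
      refine ⟨s * t, mul_ne_zero hs ht, C t * P + C s * Q, ?_, ?_⟩
      · simp only [map_mul, map_add, aeval_C, ← hP, ← hQ]; ring
      · intro k _ φ _ hφ
        rw [map_mul] at hφ
        rw [map_add, map_mul, map_mul, spMap_C, spMap_C]
        exact add_mem
          (mul_mem (Subalgebra.algebraMap_mem _ _) (hPk k φ (left_ne_zero_of_mul hφ)))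
          (mul_mem (Subalgebra.algebraMap_mem _ _) (hQk k φ (right_ne_zero_of_mul hφ)))
    | mul x y _ _ hx hy =>
      obtain ⟨s, hs, P, hP, hPk⟩ := hx
      obtain ⟨t, ht, Q, hQ, hQk⟩ := hy
      refine ⟨s * t, mul_ne_zero hs ht, P * Q, ?_, ?_⟩
      · simp only [map_mul, ← hP, ← hQ]; ring
      · intro k _ φ _ hφ
        rw [map_mul] at hφ
        rw [map_mul]
        exact mul_mem (hPk k φ (left_ne_zero_of_mul hφ)) (hQk k φ (right_ne_zero_of_mul hφ))
  obtain ⟨s, hs, P, hP, hPk⟩ := good θ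
  refine ⟨s, hs, fun k _ φ _ hφ => ?_⟩
  have h1 := spMap_eq_zero f φ hf θ hmin (C s * X - P) (by simp [hP])
  rw [map_sub, map_mul, spMap_C, sub_eq_zero] at h1
  have hX : spMap f φ X = AdjoinRoot.root (f.map φ) := by simp [spMap]
  rw [hX] at h1
  have h2 := hPk k φ hφ
  rw [← h1] at h2
  have hs' : algebraMap k (AdjoinRoot (f.map φ)) (φ s) ≠ 0 := by simpa using hφ
  have h3 : AdjoinRoot.root (f.map φ) ∈
      Algebra.adjoin k ((h.map φ).rootSet (AdjoinRoot (f.map φ))) := by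
    have := mul_mem (Subalgebra.algebraMap_mem _ (φ s)⁻¹) h2
    rwa [← mul_assoc, ← map_mul, inv_mul_cancel₀ hφ, map_one, one_mul] at this
  rw [eq_top_iff, ← AdjoinRoot.adjoinRoot_eq_top, Algebra.adjoin_le_iff]
  simpa using h3

theorem spec_splits (f : A[X]) (hf : f.Monic) (θ : L) (hθ : Algebra.adjoin E {θ} = ⊤)
    (hmin : f.map (algebraMap A E) = minpoly E θ) (h : A[X])
    (hspl : (h.map (algebraMap A L)).Splits) :
    ∃ s : A, s ≠ 0 ∧ ∀ (k : Type v) [Field k] (φ : A →+* k) [Fact (Irreducible (f.map φ))],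
      φ s ≠ 0 → ((h.map φ).map (algebraMap k (AdjoinRoot (f.map φ)))).Splits := by
  choose s hs P hP using exists_denom (A := A) (E := E) θ hθ
  let R := (h.map (algebraMap A L)).roots
  have hAL : algebraMap A L = (aeval (R := A) θ).toRingHom.comp C := by ext; simp
  let Q1 : A[X][X] := C (C h.leadingCoeff) * (R.map fun α => C (C (s α)) * X - C (P α)).prod
  let Q2 : A[X][X] := C (C (R.map s).prod) * h.map C
  have hinj : Function.Injective (algebraMap A L) := by
    rw [IsScalarTower.algebraMap_eq A E L]
    exact (algebraMap E L).injective.comp (IsFractionRing.injective A E)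
  have hQ : (Q1 - Q2).map (aeval (R := A) θ).toRingHom = 0 := by
    rw [Polynomial.map_sub, sub_eq_zero]
    simp only [Q1, Q2, Polynomial.map_mul, map_C, Polynomial.map_multiset_prod, Multiset.map_map,
      Polynomial.map_map, ← hAL]
    rw [hspl.eq_prod_roots, leadingCoeff_map_of_injective hinj]
    have e1 : ∀ a : A, (aeval (R := A) θ).toRingHom (C a) = algebraMap A L a := by intro a; simp
    have e2 : ∀ p : A[X], (aeval (R := A) θ).toRingHom p = aeval θ p := fun _ => rfl
    have e3 : (map (aeval (R := A) θ).toRingHom ∘ fun α => C (C (s α)) * X - C (P α)) =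
        fun α => C (algebraMap A L (s α)) * (X - C α) := by
      funext α
      simp only [Function.comp, Polynomial.map_sub, Polynomial.map_mul, map_C, map_X, e1]
      rw [e2, ← hP, C_mul]; ring
    rw [e3, e1, e1, Multiset.prod_map_mul, map_multiset_prod, map_multiset_prod]
    simp only [Multiset.map_map, R, Function.comp_def]
    ring
  refine ⟨(R.map s).prod, ?_, fun k _ φ _ hφ => ?_⟩
  · rw [Ne, Multiset.prod_eq_zero_iff]
    simp only [Multiset.mem_map, not_exists, not_and]
    exact fun x _ => hs x
  · have hQ' : (Q1 - Q2).map (spMap f φ) = 0 := by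
      ext i
      rw [coeff_map, coeff_zero]
      apply spMap_eq_zero f φ hf θ hmin
      have := congrArg (fun p => p.coeff i) hQ
      simpa using this
    have hs' : algebraMap k (AdjoinRoot (f.map φ)) (φ (R.map s).prod) ≠ 0 := by simpa using hφ
    have hC : (spMap f φ).comp C = (algebraMap k _).comp φ := by
      ext a; exact spMap_C f φ a
    rw [Polynomial.map_sub, sub_eq_zero] at hQ'
    have h2 : Q2.map (spMap f φ) = C (algebraMap k (AdjoinRoot (f.map φ)) (φ (R.map s).prod)) *
        (h.map φ).map (algebraMap k (AdjoinRoot (f.map φ))) := by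
      simp only [Q2, Polynomial.map_mul, map_C, spMap_C, Polynomial.map_map, hC]
    have h3 : (Q1.map (spMap f φ)).Splits := by
      simp only [Q1, Polynomial.map_mul, map_C, Polynomial.map_multiset_prod, Multiset.map_map]
      apply Splits.C_mul
      apply Splits.multisetProd
      intro g hg
      obtain ⟨α, _, rfl⟩ := Multiset.mem_map.1 hg
      apply Splits.of_natDegree_le_one
      simp only [Function.comp, Polynomial.map_sub, Polynomial.map_mul, map_C, map_X]
      compute_degree
    rw [hQ', h2] at h3
    have h4 := h3.C_mul (algebraMap k (AdjoinRoot (f.map φ)) (φ (R.map s).prod))⁻¹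
    rwa [← mul_assoc, ← C_mul, inv_mul_cancel₀ hs', C_1, one_mul] at h4

theorem spec_sep (h : A[X]) (hsep : (h.map (algebraMap A E)).Separable) :
    ∃ s : A, s ≠ 0 ∧ ∀ (k : Type v) [Field k] (φ : A →+* k), φ s ≠ 0 →
      (h.map φ).Separable := by
  obtain ⟨a, b, hab⟩ := hsep
  obtain ⟨c, hcM, hc⟩ := IsLocalization.integerNormalization_spec (nonZeroDivisors A) a
  obtain ⟨d, hdM, hd⟩ := IsLocalization.integerNormalization_spec (nonZeroDivisors A) b
  set a' := IsLocalization.integerNormalization (nonZeroDivisors A) a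
  set b' := IsLocalization.integerNormalization (nonZeroDivisors A) b
  have key : C (d : A) * a' * h + C (c : A) * b' * derivative h = C (c * d : A) := by
    apply Polynomial.map_injective (algebraMap A E) (IsFractionRing.injective A E)
    have hc' : map (algebraMap A E) a' = C (algebraMap A E c) * a := by
      rw [hc, ← smul_eq_C_mul, algebraMap_smul]
    have hd' : map (algebraMap A E) b' = C (algebraMap A E d) * b := by
      rw [hd, ← smul_eq_C_mul, algebraMap_smul]
    rw [derivative_map] at hab
    simp only [Polynomial.map_add, Polynomial.map_mul, map_C, hc', hd', map_mul]
    linear_combination (C (algebraMap A E c) * C (algebraMap A E d)) * hab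
  refine ⟨c * d, mul_ne_zero (nonZeroDivisors.ne_zero hcM) (nonZeroDivisors.ne_zero hdM),
    fun k _ φ hφ => ?_⟩
  have := congrArg (map φ) key
  simp only [Polynomial.map_add, Polynomial.map_mul, map_C, ← derivative_map] at this
  refine ⟨C (φ (c * d))⁻¹ * (C (φ d) * map φ a'), C (φ (c * d))⁻¹ * (C (φ c) * map φ b'), ?_⟩
  have h1 : C (φ (c * d))⁻¹ * C (φ (c * d)) = 1 := by
    rw [← C_mul, inv_mul_cancel₀ hφ, C_1]
  linear_combination C (φ (c * d))⁻¹ * this + h1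

theorem spec_main (f : A[X]) (hf : f.Monic) (θ : L) (hθ : Algebra.adjoin E {θ} = ⊤)
    (hmin : f.map (algebraMap A E) = minpoly E θ) (h : A[X])
    (hsep : (h.map (algebraMap A E)).Separable)
    [IsSplittingField E L (h.map (algebraMap A E))] :
    ∃ s : A, s ≠ 0 ∧ ∀ (k : Type v) [Field k] (φ : A →+* k), Irreducible (f.map φ) → φ s ≠ 0 →
      (h.map φ).natDegree = h.natDegree ∧ (h.map φ).Separable ∧
        Nat.card (h.map φ).Gal = f.natDegree := by
  have hh : h ≠ 0 := by rintro rfl; simpa using hsep.ne_zero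
  obtain ⟨s1, hs1, H1⟩ := spec_sep.{v} h hsep
  obtain ⟨s2, hs2, H2⟩ := spec_gen.{v} f hf θ hθ hmin h hh (IsSplittingField.adjoin_rootSet L _)
  obtain ⟨s3, hs3, H3⟩ := spec_splits.{v} f hf θ hθ hmin h (by
    have := IsSplittingField.splits L (h.map (algebraMap A E))
    rwa [Polynomial.map_map, ← IsScalarTower.algebraMap_eq] at this)
  refine ⟨s1 * s2 * s3 * h.leadingCoeff, mul_ne_zero (mul_ne_zero (mul_ne_zero hs1 hs2) hs3)
    (leadingCoeff_ne_zero.2 hh), fun k _ φ hirr hφ => ?_⟩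
  simp only [map_mul, mul_ne_zero_iff] at hφ
  obtain ⟨⟨⟨h1, h2⟩, h3⟩, h4⟩ := hφ
  have := Fact.mk hirr
  refine ⟨natDegree_map_of_leadingCoeff_ne_zero _ h4, H1 k φ h1, ?_⟩
  have : IsSplittingField k (AdjoinRoot (f.map φ)) (h.map φ) := ⟨H3 k φ h3, H2 k φ h2⟩
  rw [Gal.card_of_separable (H1 k φ h1),
    ← (IsSplittingField.algEquiv (AdjoinRoot (f.map φ)) (h.map φ)).toLinearEquiv.finrank_eq,
    (AdjoinRoot.powerBasis hirr.ne_zero).finrank, AdjoinRoot.powerBasis_dim, hf.natDegree_map]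
end spec

theorem isFractionRing_aux (K : Type u) [Field K] [NumberField K] :
    letI := (toRatFuncConst K).toAlgebra
    IsFractionRing (𝓞 K)[X] (RatFunc K) := by
  letI := (toRatFuncConst K).toAlgebra
  have hinj : Function.Injective (toRatFuncConst K) :=
    (IsFractionRing.injective K[X] (RatFunc K)).comp
      (Polynomial.map_injective _ (IsFractionRing.injective (𝓞 K) K))
  have : FaithfulSMul (𝓞 K)[X] (RatFunc K) := (faithfulSMul_iff_algebraMap_injective _ _).2 hinj
  have hnum : ∀ p : K[X], ∃ b : 𝓞 K, b ≠ 0 ∧ ∃ q : (𝓞 K)[X],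
      toRatFuncConst K q = toRatFuncConst K (C b) * algebraMap K[X] (RatFunc K) p := by
    intro p
    obtain ⟨b, hb, h⟩ := IsLocalization.integerNormalization_spec (nonZeroDivisors (𝓞 K)) p
    refine ⟨b, nonZeroDivisors.ne_zero hb,
      IsLocalization.integerNormalization (nonZeroDivisors (𝓞 K)) p, ?_⟩
    · simp only [toRatFuncConst, RingHom.comp_apply, coe_mapRingHom, map_C]
      rw [h, ← map_mul, ← smul_eq_C_mul, algebraMap_smul]
  apply IsFractionRing.of_field
  intro z
  obtain ⟨p, q, hq, rfl⟩ := IsFractionRing.div_surjective (A := K[X]) z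
  obtain ⟨b, hb, P, hP⟩ := hnum p
  obtain ⟨c, hc, Q, hQ⟩ := hnum q
  refine ⟨C c * P, C b * Q, ?_⟩
  change _ = toRatFuncConst K _ / toRatFuncConst K _
  have hb' : toRatFuncConst K (C b) ≠ 0 := by
    rw [Ne, map_eq_zero_iff _ hinj]; simpa using hb
  have hc' : toRatFuncConst K (C c) ≠ 0 := by
    rw [Ne, map_eq_zero_iff _ hinj]; simpa using hc
  have hq' : algebraMap K[X] (RatFunc K) q ≠ 0 := by
    simpa using nonZeroDivisors.ne_zero hq
  rw [map_mul, map_mul, hP, hQ]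
  field_simp

/-- Let `h ∈ 𝓞_K[t][x]` be irreducible of degree `D ≥ 1` in `x` over
`K(t)`, with `K` algebraically closed in a splitting field of `h` over `K(t)`.  Then for
all but finitely many nonzero primes `𝔭` of `𝓞_K`, the reduction `h_𝔭` has degree `D`
and `D` distinct roots in an algebraic closure of `κ(𝔭)(t)`, and the Galois group of a
splitting field of `h_𝔭` over `κ(𝔭)(t)` has the same order as that of `h` over
`K(t)`. -/
theorem specialization_of_galois_groups {K : Type*} [Field K] [NumberField K]
    (h : Polynomial (Polynomial (𝓞 K))) (D : ℕ) (hD : 1 ≤ D)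
    (hirr : Irreducible (h.map (toRatFuncConst K)))
    (hdeg : (h.map (toRatFuncConst K)).natDegree = D)
    (halg : ∀ x : (h.map (toRatFuncConst K)).SplittingField,
      (∃ g : Polynomial K, g ≠ 0 ∧
        Polynomial.eval₂ (constEmb K (h.map (toRatFuncConst K))) x g = 0) →
      x ∈ Set.range (constEmb K (h.map (toRatFuncConst K)))) :
    ∃ T : Finset (Ideal (𝓞 K)),
      ∀ (𝔭 : Ideal (𝓞 K)) (hp : 𝔭.IsPrime) (h0 : 𝔭 ≠ ⊥), 𝔭 ∉ T →
        specializesWell h D (Nat.card (h.map (toRatFuncConst K)).Gal) 𝔭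
          (hp.isMaximal h0) := by
  letI : Algebra (𝓞 K)[X] (RatFunc K) := (toRatFuncConst K).toAlgebra
  haveI : IsFractionRing (𝓞 K)[X] (RatFunc K) := isFractionRing_aux K
  have hinj : Function.Injective (toRatFuncConst K) := IsFractionRing.injective _ (RatFunc K)
  have hsep : (h.map (toRatFuncConst K)).Separable := hirr.separable
  have hhD : h.natDegree = D := by rw [← hdeg, natDegree_map_eq_of_injective hinj]
  set L := (h.map (toRatFuncConst K)).SplittingField with hL
  haveI : IsSplittingField (RatFunc K) L (h.map (algebraMap (𝓞 K)[X] (RatFunc K))) :=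
    IsSplittingField.splittingField (h.map (toRatFuncConst K))
  obtain ⟨θ₀, hθ₀⟩ := Field.exists_primitive_element (RatFunc K) L
  have halgθ : IsAlgebraic (𝓞 K)[X] θ₀ := by
    rw [IsFractionRing.isAlgebraic_iff (𝓞 K)[X] (RatFunc K) L]
    exact Algebra.IsAlgebraic.isAlgebraic θ₀
  obtain ⟨y, hy, hint⟩ := halgθ.exists_integral_multiple
  set θ : L := y • θ₀ with hθdef
  have hy' : algebraMap (𝓞 K)[X] (RatFunc K) y ≠ 0 := by
    rw [Ne, map_eq_zero_iff _ (IsFractionRing.injective _ (RatFunc K))]; exact hy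
  have hθ : (RatFunc K)⟮θ⟯ = ⊤ := by
    rw [eq_top_iff, ← hθ₀, IntermediateField.adjoin_simple_le_iff]
    have h1 : θ ∈ (RatFunc K)⟮θ⟯ := IntermediateField.mem_adjoin_simple_self _ θ
    have h2 : θ₀ = (algebraMap (𝓞 K)[X] (RatFunc K) y)⁻¹ • θ := by
      rw [hθdef, ← algebraMap_smul (RatFunc K) y θ₀, smul_smul, inv_mul_cancel₀ hy', one_smul]
    rw [h2]
    exact IntermediateField.smul_mem _ h1
  have hθ' : Algebra.adjoin (RatFunc K) {θ} = ⊤ := by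
    have h1 := IntermediateField.adjoin_simple_toSubalgebra_of_isAlgebraic
      (Algebra.IsAlgebraic.isAlgebraic (R := RatFunc K) θ)
    rw [← h1, hθ, IntermediateField.top_toSubalgebra]
  set f : (𝓞 K)[X][X] := minpoly (𝓞 K)[X] θ with hfdef
  have hf : f.Monic := minpoly.monic hint
  have hmin : f.map (algebraMap (𝓞 K)[X] (RatFunc K)) = minpoly (RatFunc K) θ :=
    (minpoly.isIntegrallyClosed_eq_field_fractions' (RatFunc K) hint).symm
  have hfdeg : f.natDegree = Module.finrank (RatFunc K) L := by
    rw [← hf.natDegree_map (algebraMap (𝓞 K)[X] (RatFunc K)), hmin,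
      ← IntermediateField.adjoin.finrank (IsIntegral.of_finite (RatFunc K) θ), hθ]
    exact IntermediateField.finrank_top'
  have hcard : Nat.card (h.map (toRatFuncConst K)).Gal = f.natDegree := by
    rw [Gal.card_of_separable hsep, hfdeg]
  have hfpos : 0 < f.natDegree := minpoly.natDegree_pos hint
  obtain ⟨s, hs, Hs⟩ := spec_main f hf θ hθ' hmin h hsep
  have hcomp : ((aeval (R := K) (RatFunc.X : RatFunc K) : K[X] →ₐ[K] RatFunc K).toRingHom).comp
      (mapRingHom (algebraMap (𝓞 K) K)) = toRatFuncConst K := by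
    ext x
    · simp [toRatFuncConst]
    · simp [toRatFuncConst]
  obtain ⟨d, hd, Hd⟩ := bertini_noether (K := K) f hf hfpos (by
    intro K' _ _ _ G H hG hH hGH
    have hdegK : (f.map (mapRingHom (algebraMap (𝓞 K) K))).natDegree = f.natDegree :=
      hf.natDegree_map _
    refine abs_irr (K := K) (E := RatFunc K) (L := L) ?_ θ hθ RatFunc.X
      (f.map (mapRingHom (algebraMap (𝓞 K) K))) (hf.map _) (hdegK.trans hfdeg) ?_ G H
      (by rwa [hdegK]) (by rwa [hdegK]) ?_
    · intro x hx
      obtain ⟨g, hg, hgx⟩ := hx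
      obtain ⟨z, hz⟩ := halg x ⟨g, hg.ne_zero, by
        rw [← hgx, constEmb, ← IsScalarTower.algebraMap_eq]⟩
      refine ⟨z, ?_⟩
      rw [← hz, constEmb, ← IsScalarTower.algebraMap_eq]
    · rw [Polynomial.map_map, hcomp]
      change aeval θ (f.map (algebraMap (𝓞 K)[X] (RatFunc K))) = 0
      rw [hmin, minpoly.aeval]
    · rw [hGH, Polynomial.map_map, mapRingHom_comp])
  have hfin := Ring.HasFiniteQuotients.finite_setOfPred_mem (d * s.leadingCoeff)
    (mul_ne_zero hd (leadingCoeff_ne_zero.2 hs))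
  refine ⟨hfin.toFinset, fun 𝔭 hp h0 hT => ?_⟩
  have hT' : d * s.leadingCoeff ∉ 𝔭 := by simpa using hT
  have hmax := hp.isMaximal h0
  letI : Field (𝓞 K ⧸ 𝔭) := Ideal.Quotient.field 𝔭
  have hd' : Ideal.Quotient.mk 𝔭 d ≠ 0 := by
    rw [Ne, Ideal.Quotient.eq_zero_iff_mem]
    exact fun hh => hT' (Ideal.mul_mem_right _ _ hh)
  have hs' : Ideal.Quotient.mk 𝔭 s.leadingCoeff ≠ 0 := by
    rw [Ne, Ideal.Quotient.eq_zero_iff_mem]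
    exact fun hh => hT' (Ideal.mul_mem_left _ _ hh)
  have hirrp : Irreducible (f.map (mapRingHom (Ideal.Quotient.mk 𝔭))) := Hd _ _ hd'
  have hirrp' := ((hf.map _).irreducible_iff_irreducible_map_fraction_map
    (K := RatFunc (𝓞 K ⧸ 𝔭))).1 hirrp
  rw [Polynomial.map_map] at hirrp'
  have hφs : ((algebraMap (Polynomial (𝓞 K ⧸ 𝔭)) (RatFunc (𝓞 K ⧸ 𝔭))).comp
        (Polynomial.mapRingHom (Ideal.Quotient.mk 𝔭))) s ≠ 0 := by
    rw [RingHom.comp_apply, Ne, map_eq_zero_iff _ (IsFractionRing.injective _ _)]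
    intro h1
    apply hs'
    rw [leadingCoeff, ← coeff_map, ← coe_mapRingHom, h1, coeff_zero]
  obtain ⟨r1, r2, r3⟩ := Hs _ _ hirrp' hφs
  rw [hcard]
  refine ⟨r1.trans hhD, ?_, r3⟩
  rw [← Nat.card_coe_set_eq, Nat.card_eq_fintype_card,
    card_rootSet_eq_natDegree r2 (IsAlgClosed.splits _)]
  exact r1.trans hhD
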